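/- arXiv:2510.16029 — 5 statements merged into one kernel-verified Lean document; each statement's English description precedes it below -/
import Mathlib

section
/- Let d ≥ 2 be a squarefree integer with d ≡ 1 (mod 3), let K = ℚ(√-d) with ring of integers O_K, and let R = O_K[1/3] be the ring of S-integers of K, where S is the set of primes of K lying above 3. Then the only pairs (α, γ) with α a unit of R, γ ∈ R, and α + 1 = γ³ are (α, γ) = (-1, 0) and (α, γ) = (-9, -2). -/
open NumberField IsDedekindDomain

theorem norm_form_eq_four_mul_three_pow {d : ℤ} (hd2 : 2 ≤ d) (hd3 : d % 3 = 1) (hd4 : d ≠ 4) :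
    ∀ (m : ℕ) (a b : ℤ), a ^ 2 + d * b ^ 2 = 4 * 3 ^ m →
      b = 0 ∧ ∃ j : ℕ, a = 2 * 3 ^ j ∨ a = -(2 * 3 ^ j) := by
  have hdvd : ∀ a b c : ℤ, a ^ 2 + d * b ^ 2 = 3 * c → 3 ∣ a ∧ 3 ∣ b := by
    intro a b c h
    have key : (a ^ 2 + d * b ^ 2) % 3 = 0 := by rw [h]; simp
    have ha : a % 3 = 0 ∨ a % 3 = 1 ∨ a % 3 = 2 := by omega
    have hb : b % 3 = 0 ∨ b % 3 = 1 ∨ b % 3 = 2 := by omega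
    rcases ha with ha | ha | ha <;> rcases hb with hb | hb | hb <;>
      simp [pow_two, Int.add_emod, Int.mul_emod, ha, hb, hd3] at key
    exact ⟨Int.dvd_of_emod_eq_zero ha, Int.dvd_of_emod_eq_zero hb⟩
  intro m
  induction m using Nat.twoStepInduction with
  | zero =>
    intro a b h
    have hb : b = 0 := by
      by_contra hb
      have : 0 < b ^ 2 := by positivity
      have hd : d ≤ 4 := by nlinarith [sq_nonneg a]
      obtain rfl | rfl : d = 2 ∨ d = 3 := by omega
      · have : b ^ 2 ≤ 2 := by nlinarith [sq_nonneg a]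
        have h1 : b ≤ 1 := by nlinarith
        have h2 : -1 ≤ b := by nlinarith
        have h3 : a ≤ 2 := by nlinarith
        have h4 : -2 ≤ a := by nlinarith
        interval_cases b <;> interval_cases a <;> omega
      · omega
    subst hb
    refine ⟨rfl, 0, ?_⟩
    have : (a - 2) * (a + 2) = 0 := by linarith
    rcases mul_eq_zero.1 this with h | h
    · left; omega
    · right; omega
  | one =>
    intro a b h
    obtain ⟨⟨a, rfl⟩, ⟨b, rfl⟩⟩ := hdvd a b 4 (by linarith)
    have : 9 * (a ^ 2 + d * b ^ 2) = 12 := by linarith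
    omega
  | more m ih _ =>
    intro a b h
    obtain ⟨⟨a, rfl⟩, ⟨b, rfl⟩⟩ := hdvd a b (4 * 3 ^ (m + 1)) (by rw [h]; ring)
    obtain ⟨rfl, j, hj⟩ := ih a b (by
      have : 9 * (a ^ 2 + d * b ^ 2) = 9 * (4 * 3 ^ m) := by linear_combination h
      linarith)
    refine ⟨by simp, j + 1, ?_⟩
    rcases hj with rfl | rfl
    · left; ring
    · right; ring

theorem int_cast_of_isIntegral {x : ℚ} (hx : IsIntegral ℤ x) : ∃ n : ℤ, (n : ℚ) = x := by
  simpa using (IsIntegrallyClosed.isIntegral_iff (R := ℤ) (K := ℚ)).1 hx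

theorem int_cast_of_pow_eq {x : ℚ} {k : ℕ} (hk : k ≠ 0) {m : ℤ} (h : x ^ k = m) :
    ∃ n : ℤ, (n : ℚ) = x := by
  apply int_cast_of_isIntegral
  apply IsIntegral.of_pow (Nat.pos_of_ne_zero hk)
  rw [h]
  exact isIntegral_algebraMap (R := ℤ) (A := ℚ) (x := m)

theorem int_cast_of_squarefree_mul_sq {d : ℤ} (hd : Squarefree d) {y : ℚ} {m : ℤ}
    (h : d * y ^ 2 = m) : ∃ n : ℤ, (n : ℚ) = y := by
  have hd0 : (d : ℚ) ≠ 0 := by exact_mod_cast hd.ne_zero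
  obtain ⟨e, he⟩ := int_cast_of_pow_eq (x := d * y) two_ne_zero (m := d * m)
    (by push_cast; rw [← h]; ring)
  have h2 : e ^ 2 = d * m := by
    have : (e : ℚ) ^ 2 = d * m := by rw [he, ← h]; ring
    exact_mod_cast this
  obtain ⟨n, rfl⟩ := (hd.dvd_pow_iff_dvd two_ne_zero).1 ⟨m, h2⟩
  exact ⟨n, mul_left_cancel₀ hd0 (by exact_mod_cast he)⟩

theorem cube_sub_one_eq_three_pow {t : ℤ} {k : ℕ} {ε : ℤ} (hε : ε = 1 ∨ ε = -1)
    (h : t ^ 3 = 1 + ε * 3 ^ k) : t = 0 ∨ t = -2 := by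
  have hfac : (t - 1) * (t ^ 2 + t + 1) = ε * 3 ^ k := by linear_combination h
  have hdvd : t ^ 2 + t + 1 ∣ 3 ^ k := by
    have h1 : t ^ 2 + t + 1 ∣ ε * 3 ^ k := ⟨t - 1, by rw [← hfac]; ring⟩
    rcases hε with rfl | rfl
    · simpa using h1
    · simpa using h1
  obtain ⟨j, -, hj⟩ := (dvd_prime_pow Int.prime_three _).1 hdvd
  have hj' : t ^ 2 + t + 1 = 3 ^ j := by
    rcases Int.associated_iff.1 hj with h | h
    · exact h
    · have : (0 : ℤ) < 3 ^ j := by positivity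
      nlinarith [sq_nonneg (2 * t + 1)]
  have hj2 : j < 2 := by
    by_contra! hj2
    have h9 : (9 : ℤ) ∣ t ^ 2 + t + 1 := by rw [hj']; exact pow_dvd_pow 3 hj2
    have h9' := Int.emod_eq_zero_of_dvd h9
    have : t % 9 = 0 ∨ t % 9 = 1 ∨ t % 9 = 2 ∨ t % 9 = 3 ∨ t % 9 = 4 ∨ t % 9 = 5 ∨ t % 9 = 6 ∨
      t % 9 = 7 ∨ t % 9 = 8 := by omega
    rcases this with ht | ht | ht | ht | ht | ht | ht | ht | ht <;>
      simp [pow_two, Int.add_emod, Int.mul_emod, ht] at h9'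
  have hle : t ^ 2 + t + 1 ≤ 3 := by rw [hj']; interval_cases j <;> norm_num
  have h1 : t ≤ 1 := by nlinarith
  have h2 : -2 ≤ t := by nlinarith
  have hpow : (3 : ℤ) ^ k ≠ 0 := by positivity
  have h3 : (3 : ℤ) ^ k % 2 = 1 := by
    exact Int.odd_iff.1 (Odd.pow (by decide))
  interval_cases t
  · simp
  · rcases hε with rfl | rfl <;> omega
  · simp
  · rcases hε with rfl | rfl <;> omega

theorem cube_ne_cube_add {u t ε : ℤ} (hu : 2 ≤ u) (hε : ε = 1 ∨ ε = -1) :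
    t ^ 3 ≠ u ^ 3 + ε := by
  intro h
  have hfac : (t - u) * (t ^ 2 + t * u + u ^ 2) = ε := by linear_combination h
  have hdvd : t ^ 2 + t * u + u ^ 2 ∣ 1 := by
    have h1 : t ^ 2 + t * u + u ^ 2 ∣ ε := ⟨t - u, by rw [← hfac]; ring⟩
    rcases hε with rfl | rfl
    · exact h1
    · simpa using h1
  nlinarith [Int.le_of_dvd one_pos hdvd, sq_nonneg (2 * t + u)]

theorem rat_cube_eq_one_add_three_zpow {c : ℚ} {k : ℤ} {ε : ℤ} (hε : ε = 1 ∨ ε = -1)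
    (h : c ^ 3 = 1 + ε * 3 ^ k) : c = 0 ∨ c = -2 := by
  have hnat (k : ℕ) (h : c ^ 3 = 1 + ε * 3 ^ k) : c = 0 ∨ c = -2 := by
    obtain ⟨t, rfl⟩ := int_cast_of_pow_eq (x := c) (k := 3) (by norm_num) (m := 1 + ε * 3 ^ k)
      (by rw [h]; push_cast; rfl)
    exact_mod_cast cube_sub_one_eq_three_pow hε (by exact_mod_cast h)
  obtain ⟨m, rfl | rfl⟩ := k.eq_nat_or_neg
  · exact hnat m (by simpa using h)
  obtain rfl | hm := Nat.eq_zero_or_pos m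
  · exact hnat 0 (by simpa using h)
  exfalso
  obtain ⟨n, r, hr, hnr⟩ : ∃ n r : ℕ, r < 3 ∧ n * 3 = r + m :=
    ⟨(m + 2) / 3, (m + 2) / 3 * 3 - m, by omega, by omega⟩
  have hpow : (3 ^ n * c) ^ 3 = ((3 ^ r * (3 ^ m + ε) : ℤ) : ℚ) := by
    have h3 : (3 : ℚ) ^ m ≠ 0 := by positivity
    rw [mul_pow, ← pow_mul, hnr, pow_add, h, zpow_neg, zpow_natCast]
    push_cast
    field_simp
  obtain ⟨t, ht⟩ := int_cast_of_pow_eq (by norm_num) hpow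
  rw [← ht] at hpow
  have ht3 : t ^ 3 = 3 ^ r * (3 ^ m + ε) := by exact_mod_cast hpow
  obtain rfl | hr0 := Nat.eq_zero_or_pos r
  · refine cube_ne_cube_add (u := 3 ^ n) (t := t) ?_ hε ?_
    · exact le_trans (by norm_num)
        (le_self_pow₀ (M₀ := ℤ) (a := 3) (by norm_num) (n := n) (by omega))
    · rw [ht3, ← pow_mul, hnr]; simp
  · have hdvd : (3 : ℤ) ∣ t := by
      refine Int.prime_three.dvd_of_dvd_pow (n := 3) ?_
      rw [ht3]
      exact (dvd_pow_self 3 hr0.ne').mul_right _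
    obtain ⟨u, rfl⟩ := hdvd
    obtain ⟨q, rfl⟩ := Nat.exists_eq_succ_of_ne_zero hm.ne'
    rw [mul_pow, Nat.succ_eq_add_one, pow_succ 3 q] at ht3
    interval_cases r <;> rcases hε with rfl | rfl <;> omega

section QuadraticField

variable {K : Type*} [Field K] {d : ℕ} {s : K}

theorem exists_rat_add_rat_mul [CharZero K] (hs : s ^ 2 = -(d : K))
    (hgen : Algebra.adjoin ℚ {s} = ⊤) (z : K) : ∃ x y : ℚ, z = x + y * s := by
  have hz : z ∈ Algebra.adjoin ℚ {s} := hgen ▸ Algebra.mem_top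
  induction hz using Algebra.adjoin_induction with
  | mem z hz => exact ⟨0, 1, by simpa using hz⟩
  | algebraMap r => exact ⟨r, 0, by simp⟩
  | add z w _ _ hz hw =>
    obtain ⟨x, y, rfl⟩ := hz
    obtain ⟨x', y', rfl⟩ := hw
    exact ⟨x + x', y + y', by push_cast; ring⟩
  | mul z w _ _ hz hw =>
    obtain ⟨x, y, rfl⟩ := hz
    obtain ⟨x', y', rfl⟩ := hw
    exact ⟨x * x' - d * (y * y'), x * y' + y * x', by
      push_cast; linear_combination (y * y' : K) * hs⟩

theorem ne_rat_cast [CharZero K] (hd : 0 < d) (hs : s ^ 2 = -(d : K)) (q : ℚ) : s ≠ q := by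
  rintro rfl
  have h : q ^ 2 = -(d : ℚ) := by exact_mod_cast hs
  have : (0 : ℚ) < d := by exact_mod_cast hd
  nlinarith [sq_nonneg q]

theorem eq_of_rat_add_rat_mul_eq_rat [CharZero K] (hd : 0 < d) (hs : s ^ 2 = -(d : K))
    {x y q : ℚ} (h : (x + y * s : K) = q) : x = q ∧ y = 0 := by
  have hy : y = 0 := by
    by_contra hy
    have hy' : (y : K) ≠ 0 := by exact_mod_cast hy
    refine ne_rat_cast hd hs ((q - x) / y) ?_
    push_cast
    rw [eq_div_iff hy']
    linear_combination h
  subst hy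
  exact ⟨by simpa using h, rfl⟩

theorem three_mul_sq_ne (hd3 : ¬ 3 ∣ d) {x y : ℚ} (hy : y ≠ 0) : 3 * x ^ 2 ≠ d * y ^ 2 := by
  intro h
  have hd0 : d ≠ 0 := by rintro rfl; simp at hd3
  have hx : x ≠ 0 := by
    rintro rfl
    have : (d : ℚ) * y ^ 2 ≠ 0 := by positivity
    exact this (by rw [← h]; simp)
  have h2 := congrArg (padicValRat 3) h
  have h3 : padicValRat 3 (3 : ℚ) = 1 := by
    exact_mod_cast padicValRat.self (p := 3) (by norm_num)
  have hd : padicValRat 3 (d : ℚ) = 0 := by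
    rw [padicValRat.of_nat, padicValNat.eq_zero_of_not_dvd hd3]; rfl
  rw [padicValRat.mul (by norm_num) (by positivity),
    padicValRat.mul (by exact_mod_cast hd0) (by positivity),
    padicValRat.pow, padicValRat.pow, h3, hd] at h2
  push_cast at h2
  omega

/-- A cube root in `K` of a rational number is rational, provided `K` is not `ℚ(√-3)`. -/
theorem exists_rat_of_cube_eq_rat [CharZero K] (hd : ¬ 3 ∣ d) (hs : s ^ 2 = -(d : K))
    (hgen : Algebra.adjoin ℚ {s} = ⊤) {z : K} {q : ℚ} (hz : z ^ 3 = q) :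
    ∃ c : ℚ, z = c := by
  have hd0 : 0 < d := Nat.pos_of_ne_zero (by rintro rfl; simp at hd)
  obtain ⟨x, y, rfl⟩ := exists_rat_add_rat_mul hs hgen z
  have h : ((x ^ 3 - 3 * d * x * y ^ 2 : ℚ) + (y * (3 * x ^ 2 - d * y ^ 2) : ℚ) * s : K) = q := by
    rw [← hz]
    push_cast
    linear_combination (-3 * x * y ^ 2 - y ^ 3 * s : K) * hs
  obtain hy | hxy := mul_eq_zero.1 (eq_of_rat_add_rat_mul_eq_rat hd0 hs h).2
  · exact ⟨x, by simp [hy]⟩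
  · by_cases hy : y = 0
    · exact ⟨x, by simp [hy]⟩
    · exact absurd (sub_eq_zero.1 hxy) (three_mul_sq_ne hd hy)

theorem conj_eq_neg_of_sq_eq_neg {z : ℂ} {d : ℕ} (hz : z ^ 2 = -(d : ℂ)) :
    starRingEnd ℂ z = -z := by
  have hre := congrArg Complex.re hz
  have him := congrArg Complex.im hz
  simp [pow_two] at hre him
  have h0 : z.re = 0 := by
    by_contra h
    have : z.im = 0 := by
      have : z.re * z.im = 0 := by linarith
      simpa [h] using this
    rw [this] at hre
    have : (0 : ℝ) ≤ d := by positivity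
    have : 0 < z.re * z.re := mul_self_pos.2 h
    linarith
  apply Complex.ext <;> simp [h0]

theorem normSq_map_rat_add_rat_mul [NumberField K] (hs : s ^ 2 = -(d : K)) (σ : K →+* ℂ)
    (x y : ℚ) :
    σ (x + y * s) * starRingEnd ℂ (σ (x + y * s)) = ((x ^ 2 + d * y ^ 2 : ℚ) : ℂ) := by
  have hσ : σ s ^ 2 = -(d : ℂ) := by rw [← map_pow, hs]; simp
  simp only [map_add, map_mul, map_ratCast, conj_eq_neg_of_sq_eq_neg hσ]
  push_cast
  linear_combination -(y ^ 2 : ℂ) * hσ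

theorem exists_int_of_isIntegral [NumberField K] (hdsq : Squarefree d) (hs : s ^ 2 = -(d : K))
    {x y : ℚ} (hz : IsIntegral ℤ (x + y * s : K)) :
    ∃ a b n : ℤ, 2 * x = a ∧ 2 * y = b ∧ x ^ 2 + d * y ^ 2 = n := by
  obtain ⟨σ⟩ : Nonempty (K →+* ℂ) := inferInstance
  have hσ : σ s ^ 2 = -(d : ℂ) := by rw [← map_pow, hs]; simp
  have hz1 : IsIntegral ℤ (σ (x + y * s)) := hz.map σ.toIntAlgHom
  have hz2 : IsIntegral ℤ (starRingEnd ℂ (σ (x + y * s))) :=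
    hz1.map (starRingEnd ℂ).toIntAlgHom
  have hrat {q : ℚ} (hq : IsIntegral ℤ (q : ℂ)) : ∃ n : ℤ, (n : ℚ) = q := by
    refine int_cast_of_isIntegral ((isIntegral_algebraMap_iff (B := ℂ) ?_).1 (by simpa using hq))
    exact (algebraMap ℚ ℂ).injective
  obtain ⟨a, ha⟩ := hrat (q := 2 * x) (by
    have hsum : ((2 * x : ℚ) : ℂ) = σ (x + y * s) + starRingEnd ℂ (σ (x + y * s)) := by
      simp only [map_add, map_mul, map_ratCast, conj_eq_neg_of_sq_eq_neg hσ]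
      push_cast
      ring
    rw [hsum]
    exact hz1.add hz2)
  obtain ⟨n, hn⟩ := hrat (q := x ^ 2 + d * y ^ 2) (by
    rw [← normSq_map_rat_add_rat_mul hs σ]
    exact hz1.mul hz2)
  obtain ⟨b, hb⟩ := int_cast_of_squarefree_mul_sq (d := d) (Int.squarefree_natCast.2 hdsq)
    (y := 2 * y) (m := 4 * n - a ^ 2) (by push_cast; rw [ha, hn]; ring)
  exact ⟨a, b, n, ha.symm, hb.symm, hn.symm⟩

/-- The only divisors of powers of `3` in the ring of integers of `ℚ(√-d)` are, up to sign, the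
powers of `3`. -/
theorem eq_three_pow_of_mul_eq_three_pow [NumberField K] (hd2 : 2 ≤ d) (hdsq : Squarefree d)
    (hd3 : d % 3 = 1) (hs : s ^ 2 = -(d : K)) (hgen : Algebra.adjoin ℚ {s} = ⊤) {z w : K}
    (hz : IsIntegral ℤ z) (hw : IsIntegral ℤ w) {M : ℕ} (hzw : z * w = 3 ^ M) :
    ∃ j : ℕ, z = 3 ^ j ∨ z = -3 ^ j := by
  obtain ⟨σ⟩ : Nonempty (K →+* ℂ) := inferInstance
  obtain ⟨x, y, rfl⟩ := exists_rat_add_rat_mul hs hgen z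
  obtain ⟨x', y', rfl⟩ := exists_rat_add_rat_mul hs hgen w
  obtain ⟨a, b, n, ha, hb, hn⟩ := exists_int_of_isIntegral hdsq hs hz
  obtain ⟨a', b', n', ha', hb', hn'⟩ := exists_int_of_isIntegral hdsq hs hw
  have hnn : n * n' = 3 ^ (2 * M) := by
    have h1 : ((n * n' : ℚ) : ℂ) = ((3 ^ (2 * M) : ℚ) : ℂ) := by
      rw [← hn, ← hn', Rat.cast_mul, ← normSq_map_rat_add_rat_mul hs σ,
        ← normSq_map_rat_add_rat_mul hs σ, mul_mul_mul_comm, ← map_mul, ← map_mul, ← map_mul, hzw]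
      simp only [map_pow, map_ofNat]
      push_cast
      ring
    exact_mod_cast h1
  have hn0 : 0 ≤ n := by
    have : (0 : ℚ) ≤ n := by rw [← hn]; positivity
    exact_mod_cast this
  obtain ⟨m, -, hm⟩ := (dvd_prime_pow Int.prime_three _).1 ⟨n', hnn.symm⟩
  have hnm : n = 3 ^ m := by
    rcases Int.associated_iff.1 hm with h | h
    · exact h
    · have : (0 : ℤ) < 3 ^ m := by positivity
      omega
  have hab : a ^ 2 + (d : ℤ) * b ^ 2 = 4 * 3 ^ m := by
    have : (a : ℚ) ^ 2 + d * b ^ 2 = 4 * n := by rw [← ha, ← hb, ← hn]; ring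
    rw [← hnm]
    exact_mod_cast this
  have hd4 : (d : ℤ) ≠ 4 := by
    intro h
    obtain rfl : d = 4 := by exact_mod_cast h
    have := Nat.isUnit_iff.1 (hdsq 2 (by norm_num))
    omega
  obtain ⟨rfl, j, hj⟩ := norm_form_eq_four_mul_three_pow (by omega) (by omega) hd4 m a b hab
  have hy : y = 0 := by simpa using hb
  have hx : x = 3 ^ j ∨ x = -3 ^ j := by
    rcases hj with rfl | rfl <;> push_cast at ha
    · left; linarith
    · right; linarith
  refine ⟨j, ?_⟩
  rcases hx with rfl | rfl <;> simp [hy]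

end QuadraticField

theorem exists_pow_mul_isIntegral_of_mem_integer {K : Type*} [Field K] [NumberField K] {r : 𝓞 K}
    (hr : r ≠ 0) {z : K} (hz : z ∈ {v : HeightOneSpectrum (𝓞 K) | r ∈ v.asIdeal}.integer K) :
    ∃ N : ℕ, IsIntegral ℤ ((r : K) ^ N * z) := by
  have hr0 : (r : K) ≠ 0 := by simpa using hr
  have hlocal (v : HeightOneSpectrum (𝓞 K)) :
      ∃ N : ℕ, ∀ n ≥ N, v.valuation K ((r : K) ^ n * z) ≤ 1 := by
    have hr1 : v.valuation K (r : K) ≤ 1 := v.valuation_le_one r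
    by_cases hv : r ∈ v.asIdeal
    · obtain rfl | hz0 := eq_or_ne z 0
      · simp
      have hlt : v.valuation K (r : K) < 1 := (v.valuation_lt_one_iff_mem r).2 hv
      have hzv : v.valuation K z ≠ 0 := by simpa using hz0
      obtain ⟨N, hN⟩ := exists_pow_lt₀ hlt (Units.mk0 _ (inv_ne_zero hzv))
      refine ⟨N, fun n hn => ?_⟩
      rw [map_mul, map_pow, ← le_mul_inv_iff₀ (zero_lt_iff.2 hzv), one_mul]
      exact (pow_le_pow_right_of_le_one' hr1 hn).trans hN.le
    · refine ⟨0, fun n _ => ?_⟩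
      rw [map_mul, map_pow]
      exact mul_le_one' (pow_le_one' hr1 n) (hz v hv)
  choose N hN using hlocal
  have hfin : {v : HeightOneSpectrum (𝓞 K) | 1 < v.valuation K z}.Finite :=
    HeightOneSpectrum.Support.finite (𝓞 K) z
  refine ⟨hfin.toFinset.sup N, ?_⟩
  obtain ⟨w, hw⟩ := HeightOneSpectrum.mem_integers_of_valuation_le_one (R := 𝓞 K) K
      ((r : K) ^ hfin.toFinset.sup N * z) fun v => by
    by_cases hv : 1 < v.valuation K z
    · exact hN v _ (Finset.le_sup (by simpa using hv))
    · rw [map_mul, map_pow]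
      exact mul_le_one' (pow_le_one' (v.valuation_le_one r) _) (not_lt.1 hv)
  rw [← hw]
  exact RingOfIntegers.isIntegral_coe w

/-- Let `d ≥ 2` be squarefree with `d ≡ 1 (mod 3)`, `K = ℚ(√-d)`, and let
`R = O_K[1/3]` be the ring of `S`-integers of `K`, where `S` is the set of primes of `K`
lying above `3`. The only pairs `(α, γ)` with `α` a unit of `R`, `γ ∈ R` and
`α + 1 = γ³` are `(-1, 0)` and `(-9, -2)`. -/
theorem s_unit_equation_imaginary_quadratic
    (d : ℕ) (hd2 : 2 ≤ d) (hdsq : Squarefree d) (hd3 : d % 3 = 1)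
    (K : Type*) [Field K] [NumberField K] (s : K) (hs : s ^ 2 = -(d : K))
    (hgen : Algebra.adjoin ℚ {s} = ⊤)
    (S : Set (HeightOneSpectrum (𝓞 K)))
    (hS : S = {v : HeightOneSpectrum (𝓞 K) | (3 : 𝓞 K) ∈ v.asIdeal})
    (α γ : S.integer K) (hα : IsUnit α) (heq : α + 1 = γ ^ 3) :
    (α = -1 ∧ γ = 0) ∨ (α = -9 ∧ γ = -2) := by
  have hd3' : ¬ 3 ∣ d := by omega
  have h3 : (3 : 𝓞 K) ≠ 0 := by norm_num
  subst hS
  obtain ⟨β, hαβ⟩ := hα.exists_right_inv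
  have hαβK : (α : K) * (β : K) = 1 := congrArg Subtype.val hαβ
  have heqK : (α : K) + 1 = (γ : K) ^ 3 := congrArg Subtype.val heq
  obtain ⟨N, hN⟩ := exists_pow_mul_isIntegral_of_mem_integer h3 α.2
  obtain ⟨M, hM⟩ := exists_pow_mul_isIntegral_of_mem_integer h3 β.2
  rw [show ((3 : 𝓞 K) : K) = 3 from map_ofNat _ 3] at hN hM
  obtain ⟨j, hj⟩ := eq_three_pow_of_mul_eq_three_pow hd2 hdsq hd3 hs hgen hN hM (M := N + M)
    (by rw [mul_mul_mul_comm, hαβK, mul_one, pow_add])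
  obtain ⟨ε, hε, hα⟩ : ∃ ε : ℤ, (ε = 1 ∨ ε = -1) ∧
      (α : K) = ((ε * 3 ^ ((j : ℤ) - N) : ℚ) : K) := by
    have h3 : (3 : K) ≠ 0 := by norm_num
    have h3N : (3 : K) ^ N ≠ 0 := pow_ne_zero _ h3
    rcases hj with hj | hj
    · refine ⟨1, .inl rfl, mul_left_cancel₀ h3N (hj.trans ?_)⟩
      push_cast
      rw [zpow_sub₀ h3, zpow_natCast, zpow_natCast]
      field_simp
    · refine ⟨-1, .inr rfl, mul_left_cancel₀ h3N (hj.trans ?_)⟩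
      push_cast
      rw [zpow_sub₀ h3, zpow_natCast, zpow_natCast]
      field_simp
  have hγ : (γ : K) ^ 3 = ((1 + ε * 3 ^ ((j : ℤ) - N) : ℚ) : K) := by
    rw [← heqK, hα]; push_cast; ring
  obtain ⟨c, hc⟩ := exists_rat_of_cube_eq_rat hd3' hs hgen hγ
  have hc3 : c ^ 3 = 1 + ε * 3 ^ ((j : ℤ) - N) := by
    rw [hc] at hγ
    exact_mod_cast hγ
  have hα' : α = γ ^ 3 - 1 := eq_sub_of_add_eq heq
  rcases rat_cube_eq_one_add_three_zpow hε hc3 with rfl | rfl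
  · have hγ0 : γ = 0 := Subtype.ext (by simpa using hc)
    exact .inl ⟨by rw [hα', hγ0]; ring, hγ0⟩
  · have hγ2 : γ = -2 := Subtype.ext (by rw [hc]; push_cast; rfl)
    exact .inr ⟨by rw [hα', hγ2]; ring, hγ2⟩
end

section
/- Let d ≥ 2 be a squarefree integer with d ≡ 1 (mod 3) and let K = ℚ(√-d) with ring of integers O_K. Let c ∈ O_K and let m be a nonnegative integer. If c³ = 1 + 3^(3m) or c³ = -1 + 3^(3m), then m = 0. -/
open NumberField

/-- In a `ℚ`-algebra generated by a square root of a rational number, every element has the form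
`a + b * s`. -/
theorem exists_eq_add_mul_of_adjoin_sqrt_eq_top {K : Type*} [Field K] [Algebra ℚ K] {q : ℚ} {s : K}
    (hs : s ^ 2 = algebraMap ℚ K q) (hgen : Algebra.adjoin ℚ {s} = ⊤) (x : K) :
    ∃ a b : ℚ, x = algebraMap ℚ K a + algebraMap ℚ K b * s := by
  have hx : x ∈ Algebra.adjoin ℚ {s} := hgen ▸ Algebra.mem_top
  induction hx using Algebra.adjoin_induction with
  | mem x hx => exact ⟨0, 1, by simpa using hx⟩
  | algebraMap r => exact ⟨r, 0, by simp⟩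
  | add x y _ _ hx hy =>
    obtain ⟨a, b, rfl⟩ := hx
    obtain ⟨a', b', rfl⟩ := hy
    exact ⟨a + a', b + b', by simp only [map_add]; ring⟩
  | mul x y _ _ hx hy =>
    obtain ⟨a, b, rfl⟩ := hx
    obtain ⟨a', b', rfl⟩ := hy
    refine ⟨a * a' + b * b' * q, a * b' + a' * b, ?_⟩
    simp only [map_add, map_mul, ← hs]
    ring

/-- A rational number that is a cube in an imaginary quadratic field is a cube in `ℚ`. -/
theorem exists_rat_cube_eq_of_cube_eq {K : Type*} [Field K] [Algebra ℚ K] {q : ℚ} (hq : q < 0)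
    {s : K} (hs : s ^ 2 = algebraMap ℚ K q) (hgen : Algebra.adjoin ℚ {s} = ⊤) {x : K} {N : ℚ}
    (hx : x ^ 3 = algebraMap ℚ K N) : ∃ r : ℚ, r ^ 3 = N := by
  have inj := (algebraMap ℚ K).injective
  obtain ⟨a, b, rfl⟩ := exists_eq_add_mul_of_adjoin_sqrt_eq_top hs hgen x
  have hexp : algebraMap ℚ K (b * (3 * a ^ 2 + b ^ 2 * q)) * s =
      algebraMap ℚ K (N - (a ^ 3 + 3 * a * b ^ 2 * q)) := by
    simp only [map_sub, map_add, map_mul, map_pow, map_ofNat, ← hs, ← hx]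
    ring
  have hcoeff : b * (3 * a ^ 2 + b ^ 2 * q) = 0 := by
    have hsq : (b * (3 * a ^ 2 + b ^ 2 * q)) ^ 2 * q = (N - (a ^ 3 + 3 * a * b ^ 2 * q)) ^ 2 := by
      apply inj
      rw [map_mul, map_pow, map_pow, ← hs, ← mul_pow, hexp]
    by_contra hne
    nlinarith [mul_neg_of_pos_of_neg (sq_pos_of_ne_zero hne) hq,
      sq_nonneg (N - (a ^ 3 + 3 * a * b ^ 2 * q))]
  have hN : N = a ^ 3 + 3 * a * b ^ 2 * q := by
    rw [hcoeff, map_zero, zero_mul] at hexp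
    exact sub_eq_zero.mp (inj (by rw [← hexp, map_zero]))
  rcases mul_eq_zero.mp hcoeff with hb | hb
  · exact ⟨a, by rw [hN, hb]; ring⟩
  · exact ⟨-2 * a, by rw [hN]; linear_combination -3 * a * hb⟩

/-- Let `d ≥ 2` be squarefree with `d ≡ 1 (mod 3)` and `K = ℚ(√-d)`.
If `c ∈ O_K` and `m ≥ 0` satisfy `c³ = 1 + 3^(3m)` or `c³ = -1 + 3^(3m)`, then `m = 0`. -/
theorem cube_eq_pm_one_add_three_pow
    (d : ℕ) (hd2 : 2 ≤ d) (hdsq : Squarefree d) (hd3 : d % 3 = 1)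
    (K : Type*) [Field K] [NumberField K] (s : K) (hs : s ^ 2 = -(d : K))
    (hgen : Algebra.adjoin ℚ {s} = ⊤)
    (c : 𝓞 K) (m : ℕ)
    (h : c ^ 3 = 1 + 3 ^ (3 * m) ∨ c ^ 3 = -1 + 3 ^ (3 * m)) : m = 0 := by
  by_contra hm
  have flt : FermatLastTheoremWith ℚ 3 := fermatLastTheoremFor_iff_rat.mp fermatLastTheoremThree
  have hs' : s ^ 2 = algebraMap ℚ K (-(d : ℚ)) := by simpa using hs
  have hd : -(d : ℚ) < 0 := by
    have : (0 : ℚ) < d := by exact_mod_cast (by omega : 0 < d)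
    linarith
  have hn : (1 : ℚ) < (3 ^ m) ^ 3 := one_lt_pow₀ (one_lt_pow₀ (by norm_num) hm) (by norm_num)
  have h3 : (3 ^ m : ℚ) ≠ 0 := by positivity
  have key : ∀ e : ℚ, e ^ 3 = e → e ≠ 0 → -1 ≤ e →
      (c : K) ^ 3 ≠ algebraMap ℚ K (e + (3 ^ m) ^ 3) := by
    intro e he he0 he1 hc
    obtain ⟨r, hr⟩ := exists_rat_cube_eq_of_cube_eq hd hs' hgen hc
    have hr0 : r ≠ 0 := by
      rintro rfl
      rw [zero_pow three_ne_zero] at hr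
      linarith
    exact flt e (3 ^ m) r he0 h3 hr0 (by rw [he, hr])
  rcases h with h | h
  · refine key 1 (by norm_num) (by norm_num) (by norm_num) ?_
    simpa [pow_mul', map_ofNat (algebraMap (𝓞 K) K) 3] using congrArg (algebraMap (𝓞 K) K) h
  · refine key (-1) (by norm_num) (by norm_num) (by norm_num) ?_
    simpa [pow_mul', map_ofNat (algebraMap (𝓞 K) K) 3] using congrArg (algebraMap (𝓞 K) K) h
end

section
/- Let K be a number field, p a prime number, and A, B, C, a, b, c nonzero elements of the ring of integers O_K satisfying Aa^p + Bb^p = Cc³. Then the Weierstrass curve E : Y² + 3Cc·XY + C²Bb^p·Y = X³ over K has invariants Δ_E = 27·A·B³·C⁸·(ab³)^p, c₄(E) = 9·C³·c·(9Aa^p + Bb^p), c₆(E) = -27·C⁴·(27C²c⁶ - 36Cc³Bb^p + 8B²b^(2p)); in particular Δ_E ≠ 0, E is an elliptic curve, and its j-invariant equals j_E = 27·Cc³·(9Aa^p + Bb^p)³ / (A·B³·(ab³)^p). -/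
open NumberField

/-- Let `K` be a number field, `p` prime, and `A, B, C, a, b, c` nonzero
elements of `O_K` with `A·a^p + B·b^p = C·c³`. The Frey curve
`E : Y² + 3Cc·XY + C²Bb^p·Y = X³` over `K` has invariants
`Δ_E = 27·A·B³·C⁸·(ab³)^p`, `c₄(E) = 9·C³·c·(9Aa^p + Bb^p)`,
`c₆(E) = -27·C⁴·(27C²c⁶ - 36Cc³Bb^p + 8B²b^(2p))`; in particular `Δ_E ≠ 0`, `E` is an
elliptic curve, and its `j`-invariant `c₄³/Δ` equals
`27·Cc³·(9Aa^p + Bb^p)³ / (A·B³·(ab³)^p)`. -/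
theorem frey_curve_invariants
    (K : Type*) [Field K] [NumberField K]
    (p : ℕ) (hp : p.Prime)
    (A B C a b c : 𝓞 K)
    (hA : A ≠ 0) (hB : B ≠ 0) (hC : C ≠ 0) (ha : a ≠ 0) (hb : b ≠ 0) (hc : c ≠ 0)
    (heq : A * a ^ p + B * b ^ p = C * c ^ 3)
    (E : WeierstrassCurve K)
    (hE : E = { a₁ := algebraMap (𝓞 K) K (3 * C * c), a₂ := 0,
                a₃ := algebraMap (𝓞 K) K (C ^ 2 * B * b ^ p), a₄ := 0, a₆ := 0 }) :
    E.Δ = algebraMap (𝓞 K) K (27 * A * B ^ 3 * C ^ 8 * (a * b ^ 3) ^ p) ∧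
    E.c₄ = algebraMap (𝓞 K) K (9 * C ^ 3 * c * (9 * A * a ^ p + B * b ^ p)) ∧
    E.c₆ = algebraMap (𝓞 K) K
      (-27 * C ^ 4 * (27 * C ^ 2 * c ^ 6 - 36 * C * c ^ 3 * B * b ^ p
        + 8 * B ^ 2 * b ^ (2 * p))) ∧
    E.Δ ≠ 0 ∧ E.IsElliptic ∧
    E.c₄ ^ 3 / E.Δ =
      algebraMap (𝓞 K) K (27 * C * c ^ 3 * (9 * A * a ^ p + B * b ^ p) ^ 3) /
        algebraMap (𝓞 K) K (A * B ^ 3 * (a * b ^ 3) ^ p) := by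
  have hΔ : E.Δ = algebraMap (𝓞 K) K (27 * A * B ^ 3 * C ^ 8 * (a * b ^ 3) ^ p) := by
    have heq' := congrArg (algebraMap (𝓞 K) K) heq
    subst hE
    simp only [WeierstrassCurve.Δ, WeierstrassCurve.b₂, WeierstrassCurve.b₄,
      WeierstrassCurve.b₆, WeierstrassCurve.b₈, map_mul, map_add, map_pow, map_ofNat, mul_pow,
      pow_right_comm _ 3 p] at heq' ⊢
    linear_combination -27 * algebraMap (𝓞 K) K C ^ 8 * algebraMap (𝓞 K) K B ^ 3 *
      (algebraMap (𝓞 K) K b ^ p) ^ 3 * heq'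
  have hc₄ : E.c₄ = algebraMap (𝓞 K) K (9 * C ^ 3 * c * (9 * A * a ^ p + B * b ^ p)) := by
    have heq' := congrArg (algebraMap (𝓞 K) K) heq
    subst hE
    simp only [WeierstrassCurve.c₄, WeierstrassCurve.b₂, WeierstrassCurve.b₄,
      map_mul, map_add, map_pow, map_ofNat] at heq' ⊢
    linear_combination -81 * algebraMap (𝓞 K) K C ^ 3 * algebraMap (𝓞 K) K c * heq'
  have hc₆ : E.c₆ = algebraMap (𝓞 K) K
      (-27 * C ^ 4 * (27 * C ^ 2 * c ^ 6 - 36 * C * c ^ 3 * B * b ^ p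
        + 8 * B ^ 2 * b ^ (2 * p))) := by
    subst hE
    simp only [WeierstrassCurve.c₆, WeierstrassCurve.b₂, WeierstrassCurve.b₄,
      WeierstrassCurve.b₆, map_mul, map_add, map_sub, map_neg, map_pow, map_ofNat]
    ring
  have hden : algebraMap (𝓞 K) K (A * B ^ 3 * (a * b ^ 3) ^ p) ≠ 0 := by
    simp [hA, hB, ha, hb]
  have hΔ₀ : E.Δ ≠ 0 := by
    rw [hΔ]
    simp [hA, hB, hC, ha, hb]
  refine ⟨hΔ, hc₄, hc₆, hΔ₀, ⟨hΔ₀.isUnit⟩, ?_⟩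
  rw [div_eq_div_iff hΔ₀ hden, hΔ, hc₄]
  simp only [← map_mul, ← map_pow]
  congr 1
  ring
end

section
/- Let K be a number field with ring of integers O_K, p a prime number, and A, B, C, a, b, c nonzero elements of O_K with A and B coprime, a, b, c pairwise coprime, and Aa^p + Bb^p = Cc³. Let 𝔭 be a nonzero prime ideal of O_K such that 𝔭 does not divide 3ABC but 𝔭 divides ab. Then 𝔭 does not divide 9·C³·c·(9Aa^p + Bb^p); that is, the invariant c₄(E) of the associated Frey curve E : Y² + 3Cc·XY + C²Bb^p·Y = X³ is not divisible by 𝔭. -/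
open NumberField

/-- A prime ideal containing `x` contains no element coprime to `x`. -/
theorem Ideal.IsPrime.notMem_of_isCoprime {R : Type*} [CommRing R] {P : Ideal R}
    (hP : P.IsPrime) {x y : R} (h : IsCoprime x y) (hx : x ∈ P) : y ∉ P := by
  intro hy
  obtain ⟨u, v, huv⟩ := h
  exact hP.one_notMem (huv ▸ P.add_mem (P.mul_mem_left u hx) (P.mul_mem_left v hy))

/-- Let `K` be a number field, `p` a prime, and `A, B, C, a, b, c` nonzero
elements of `O_K` with `A, B` coprime, `a, b, c` pairwise coprime, and
`A·a^p + B·b^p = C·c³`. If `𝔭` is a nonzero prime ideal of `O_K` not dividing `3ABC`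
but dividing `ab`, then `𝔭` does not divide `9·C³·c·(9Aa^p + Bb^p)`, the invariant
`c₄` of the associated Frey curve. -/
theorem frey_curve_c4_not_divisible
    (K : Type*) [Field K] [NumberField K]
    (p : ℕ) (hp : p.Prime)
    (A B C a b c : 𝓞 K)
    (hA : A ≠ 0) (hB : B ≠ 0) (hC : C ≠ 0) (ha : a ≠ 0) (hb : b ≠ 0) (hc : c ≠ 0)
    (hAB : IsCoprime A B)
    (hab : IsCoprime a b) (hac : IsCoprime a c) (hbc : IsCoprime b c)
    (heq : A * a ^ p + B * b ^ p = C * c ^ 3)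
    (𝔭 : Ideal (𝓞 K)) (h𝔭 : 𝔭.IsPrime) (h𝔭0 : 𝔭 ≠ ⊥)
    (hndvd : (3 * A * B * C : 𝓞 K) ∉ 𝔭) (hdvd : a * b ∈ 𝔭) :
    (9 * C ^ 3 * c * (9 * A * a ^ p + B * b ^ p) : 𝓞 K) ∉ 𝔭 := by
  have h3 : (3 : 𝓞 K) ∉ 𝔭 := fun h => hndvd <| by
    simpa only [mul_assoc] using 𝔭.mul_mem_right (A * (B * C)) h
  have hC' : C ∉ 𝔭 := fun h => hndvd <| 𝔭.mul_mem_left _ h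
  have h9 : (9 : 𝓞 K) ∉ 𝔭 := fun h =>
    h3 (h𝔭.mem_of_pow_mem 2 (by norm_num; exact h))
  have hc' : c ∉ 𝔭 := (h𝔭.mem_or_mem hdvd).elim
    (h𝔭.notMem_of_isCoprime hac) (h𝔭.notMem_of_isCoprime hbc)
  have hCc : C * c ^ 3 ∉ 𝔭 := h𝔭.mul_notMem hC' fun h => hc' (h𝔭.mem_of_pow_mem 3 h)
  refine h𝔭.mul_notMem (h𝔭.mul_notMem (h𝔭.mul_notMem h9 fun h =>
    hC' (h𝔭.mem_of_pow_mem 3 h)) hc') fun h => ?_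
  rcases h𝔭.mem_or_mem hdvd with h' | h'
  · refine hCc ?_
    have key : C * c ^ 3 = (9 * A * a ^ p + B * b ^ p) - 8 * A * a ^ p := by
      rw [← heq]; ring
    rw [key]
    exact 𝔭.sub_mem h (𝔭.mul_mem_left _ (𝔭.pow_mem_of_mem h' p hp.pos))
  · refine h𝔭.mul_notMem h9 hCc ?_
    have key : 9 * (C * c ^ 3) = (9 * A * a ^ p + B * b ^ p) + 8 * B * b ^ p := by
      rw [← heq]; ring
    rw [key]
    exact 𝔭.add_mem h (𝔭.mul_mem_left _ (𝔭.pow_mem_of_mem h' p hp.pos))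
end

section
/- Let K be a number field with ring of integers O_K and let T be a finite set of nonzero prime ideals of O_K containing every prime of K lying above 3. Let O_T = {x ∈ K : v_𝔮(x) ≥ 0 for every nonzero prime ideal 𝔮 ∉ T} be the ring of T-integers. Let d, e ∈ K with d ≠ 0 and e³ ≠ 27d, and set j = e³(e³ - 24d)³/(d³(e³ - 27d)). If j ∈ O_T, then λ := e³/d lies in O_T and μ := λ - 27 is a unit of O_T. -/
open NumberField IsDedekindDomain

section Valuation

variable {K Γ₀ : Type*} [Field K] [LinearOrderedCommGroupWithZero Γ₀] (v : Valuation K Γ₀)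

/-- If `l * (l - a) ^ 3 / (l - b)` is `v`-integral for `v`-integral `a` and `b`, then so is `l`. -/
lemma Valuation.le_one_of_mul_cube_div_le_one {l a b : K} (ha : v a ≤ 1) (hb : v b ≤ 1)
    (h : v (l * (l - a) ^ 3 / (l - b)) ≤ 1) : v l ≤ 1 := by
  by_contra! hl
  rw [map_div₀, map_mul, map_pow, v.map_sub_eq_of_lt_left (ha.trans_lt hl),
    v.map_sub_eq_of_lt_left (hb.trans_lt hl),
    mul_div_cancel_left₀ _ (zero_lt_one.trans hl).ne'] at h
  exact h.not_gt (one_lt_pow₀ hl three_ne_zero)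

/-- If `(m + a) * (m + b) ^ 3 / m` is `v`-integral for `v`-units `a` and `b`, then `m⁻¹` is
`v`-integral. -/
lemma Valuation.inv_le_one_of_mul_cube_div_le_one {m a b : K} (ha : v a = 1) (hb : v b = 1)
    (h : v ((m + a) * (m + b) ^ 3 / m) ≤ 1) : v m⁻¹ ≤ 1 := by
  by_contra! hm
  have hm' : v m < 1 := by
    rw [map_inv₀] at hm
    exact (one_lt_inv_iff₀.1 hm).2
  rw [map_div₀, map_mul, map_pow, v.map_add_eq_of_lt_right (hm'.trans_eq ha.symm),
    v.map_add_eq_of_lt_right (hm'.trans_eq hb.symm), ha, hb, one_pow, one_mul, one_div,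
    ← map_inv₀] at h
  exact h.not_gt hm

end Valuation

/-- Let `K` be a number field and `T` a finite set of primes of `O_K`
containing every prime above `3`. Let `O_T` be the ring of `T`-integers of `K`
(elements with nonnegative valuation at every prime outside `T`). Let `d, e ∈ K` with
`d ≠ 0`, `e³ ≠ 27d`, and set `j = e³(e³ - 24d)³/(d³(e³ - 27d))`. If `j ∈ O_T`, then
`λ = e³/d` lies in `O_T` and `μ = λ - 27` is a unit of `O_T`. -/
theorem lambda_T_integer_and_mu_T_unit
    (K : Type*) [Field K] [NumberField K]
    (T : Finset (HeightOneSpectrum (𝓞 K)))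
    (hT : ∀ v : HeightOneSpectrum (𝓞 K), (3 : 𝓞 K) ∈ v.asIdeal → v ∈ T)
    (d e : K) (hd : d ≠ 0) (he : e ^ 3 ≠ 27 * d)
    (hj : e ^ 3 * (e ^ 3 - 24 * d) ^ 3 / (d ^ 3 * (e ^ 3 - 27 * d)) ∈
      (↑T : Set (HeightOneSpectrum (𝓞 K))).integer K) :
    e ^ 3 / d ∈ (↑T : Set (HeightOneSpectrum (𝓞 K))).integer K ∧
    ∃ hμ : e ^ 3 / d - 27 ∈ (↑T : Set (HeightOneSpectrum (𝓞 K))).integer K,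
      IsUnit (⟨e ^ 3 / d - 27, hμ⟩ :
        (↑T : Set (HeightOneSpectrum (𝓞 K))).integer K) := by
  have hμ₀ : e ^ 3 / d - 27 ≠ 0 := by
    rwa [sub_ne_zero, ne_eq, div_eq_iff hd]
  have hj' : e ^ 3 * (e ^ 3 - 24 * d) ^ 3 / (d ^ 3 * (e ^ 3 - 27 * d)) =
      e ^ 3 / d * (e ^ 3 / d - 24) ^ 3 / (e ^ 3 / d - 27) := by
    have : e ^ 3 - 27 * d ≠ 0 := sub_ne_zero.2 he
    have : e ^ 3 / d - 27 = (e ^ 3 - 27 * d) / d := by field_simp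
    rw [this]
    field_simp
  rw [hj'] at hj
  generalize e ^ 3 / d = l at hj hμ₀ ⊢
  have hint (n : ℕ) (v : HeightOneSpectrum (𝓞 K)) : v.valuation K (n : K) ≤ 1 := by
    simpa using v.valuation_le_one (K := K) (n : 𝓞 K)
  have h3 (v : HeightOneSpectrum (𝓞 K)) (hv : v ∉ T) : v.valuation K (3 : K) = 1 := by
    refine le_antisymm (mod_cast hint 3 v) (not_lt.1 fun h ↦ hv (hT v ?_))
    rw [← Ideal.dvd_span_singleton, ← v.valuation_lt_one_iff_dvd (K := K)]
    rwa [← map_ofNat (algebraMap (𝓞 K) K) 3] at h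
  have hl (v : HeightOneSpectrum (𝓞 K)) (hv : v ∉ T) : v.valuation K l ≤ 1 :=
    Valuation.le_one_of_mul_cube_div_le_one _ (mod_cast hint 24 v) (mod_cast hint 27 v) (hj v hv)
  have hμ (v : HeightOneSpectrum (𝓞 K)) (hv : v ∉ T) : v.valuation K (l - 27) ≤ 1 :=
    (v.valuation K).map_sub_le (hl v hv) (mod_cast hint 27 v)
  have hμ_inv (v : HeightOneSpectrum (𝓞 K)) (hv : v ∉ T) : v.valuation K (l - 27)⁻¹ ≤ 1 := by
    refine Valuation.inv_le_one_of_mul_cube_div_le_one _ (a := 27) ?_ (h3 v hv) ?_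
    · rw [show (27 : K) = 3 ^ 3 by norm_num, map_pow, h3 v hv, one_pow]
    · convert hj v hv using 2
      ring
  exact ⟨hl, hμ, .of_mul_eq_one ⟨(l - 27)⁻¹, hμ_inv⟩ (Subtype.ext (mul_inv_cancel₀ hμ₀))⟩
end
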